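/- Let d ≥ 1, let G be a finite subgroup of O(d), and let (x̃_n) be a sequence in ℝ^d. Then there exist a subgroup G′ of G and a strictly increasing sequence of indices (n_k) such that for every g ∈ G′ the sequence (x̃_{n_k} − g x̃_{n_k})_k converges in ℝ^d, and for every g ∈ G \ G′ one has |x̃_{n_k} − g x̃_{n_k}| → ∞ as k → ∞. -/

import Mathlib

open MeasureTheory ENNReal

/-- Matrix-vector multiplication on Euclidean space. -/
noncomputable def mvE {m n : ℕ} (A : Matrix (Fin m) (Fin n) ℝ) (v : EuclideanSpace ℝ (Fin n)) :
    EuclideanSpace ℝ (Fin m) :=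
  (WithLp.equiv 2 (Fin m → ℝ)).symm (A.mulVec (WithLp.equiv 2 (Fin n → ℝ) v))

theorem exists_strictMono_tendsto_or_tendsto_norm_atTop {E : Type*} [SeminormedAddCommGroup E]
    [ProperSpace E] (y : ℕ → E) :
    ∃ n : ℕ → ℕ, StrictMono n ∧ ((∃ L, Filter.Tendsto (fun k => y (n k)) Filter.atTop (nhds L)) ∨
      Filter.Tendsto (fun k => ‖y (n k)‖) Filter.atTop Filter.atTop) := by
  by_cases h : Filter.Tendsto (fun k => ‖y k‖) Filter.atTop Filter.atTop
  · exact ⟨id, strictMono_id, Or.inr h⟩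
  · rw [Filter.tendsto_atTop] at h
    push Not at h
    obtain ⟨C, hC⟩ := h
    obtain ⟨L, -, n, hn, hL⟩ := tendsto_subseq_of_frequently_bounded
      (Metric.isBounded_closedBall (x := (0 : E)) (r := C)) (x := y)
      (hC.mono fun k hk => by simpa using (not_le.mp (by simpa using hk)).le)
    exact ⟨n, hn, Or.inl ⟨L, hL⟩⟩

/-- One subsequence settles the dichotomy between convergence
and divergence in norm for finitely many sequences at once. -/
theorem Set.Finite.exists_strictMono_tendsto_or_tendsto_norm_atTop {ι E : Type*}
    [SeminormedAddCommGroup E] [ProperSpace E] {s : Set ι} (hs : s.Finite) (y : ι → ℕ → E) :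
    ∃ n : ℕ → ℕ, StrictMono n ∧ ∀ i ∈ s,
      (∃ L, Filter.Tendsto (fun k => y i (n k)) Filter.atTop (nhds L)) ∨
        Filter.Tendsto (fun k => ‖y i (n k)‖) Filter.atTop Filter.atTop := by
  induction s, hs using Set.Finite.induction_on with
  | empty => exact ⟨id, strictMono_id, by simp⟩
  | @insert a s _ _ ih =>
    obtain ⟨n, hn, h⟩ := ih
    obtain ⟨m, hm, h'⟩ :=
      _root_.exists_strictMono_tendsto_or_tendsto_norm_atTop (fun k => y a (n k))
    refine ⟨n ∘ m, hn.comp hm, ?_⟩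
    rintro i (rfl | hi)
    · exact h'
    · exact (h i hi).imp (fun ⟨L, hL⟩ => ⟨L, hL.comp hm.tendsto_atTop⟩)
        fun hi => hi.comp hm.tendsto_atTop

theorem mvE_one {d : ℕ} (v : EuclideanSpace ℝ (Fin d)) : mvE 1 v = v := by
  simp [mvE]

theorem mvE_mul {l m n : ℕ} (A : Matrix (Fin l) (Fin m) ℝ) (B : Matrix (Fin m) (Fin n) ℝ)
    (v : EuclideanSpace ℝ (Fin n)) : mvE (A * B) v = mvE A (mvE B v) := by
  simp [mvE, Matrix.mulVec_mulVec]

theorem mvE_sub {m n : ℕ} (A : Matrix (Fin m) (Fin n) ℝ) (v w : EuclideanSpace ℝ (Fin n)) :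
    mvE A (v - w) = mvE A v - mvE A w := by
  simp [mvE, Matrix.mulVec_sub]

theorem continuous_mvE {m n : ℕ} (A : Matrix (Fin m) (Fin n) ℝ) : Continuous (mvE A) :=
  (Matrix.toEuclideanLin A).continuous_of_finiteDimensional

/-- The elements of `G` whose displacement along the sequence `y` converges. -/
def displacementConvergenceSubgroup {d : ℕ} (G : Subgroup (Matrix.orthogonalGroup (Fin d) ℝ))
    (y : ℕ → EuclideanSpace ℝ (Fin d)) : Subgroup (Matrix.orthogonalGroup (Fin d) ℝ) where
  carrier := {g | g ∈ G ∧ ∃ L, Filter.Tendsto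
    (fun k => y k - mvE (↑g : Matrix (Fin d) (Fin d) ℝ) (y k)) Filter.atTop (nhds L)}
  one_mem' := ⟨G.one_mem, 0, by simp [mvE_one]⟩
  mul_mem' := by
    rintro g h ⟨hg, L, hL⟩ ⟨hh, M, hM⟩
    refine ⟨G.mul_mem hg hh, L + mvE g.1 M,
      (hL.add (((continuous_mvE g.1).tendsto M).comp hM)).congr fun k => ?_⟩
    simp [mvE_sub, mvE_mul]
  inv_mem' := by
    rintro g ⟨hg, L, hL⟩
    refine ⟨G.inv_mem hg, -mvE (g⁻¹).1 L,
      (((continuous_mvE (g⁻¹).1).tendsto L).comp hL).neg.congr fun k => ?_⟩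
    have key : mvE (g⁻¹).1 (mvE g.1 (y k)) = y k := by
      rw [← mvE_mul]
      exact (congrArg (fun a : Matrix.orthogonalGroup (Fin d) ℝ => mvE a.1 (y k))
        (inv_mul_cancel g)).trans (mvE_one _)
    rw [Function.comp_apply, mvE_sub, key, neg_sub]

theorem stmt9 (d : ℕ) (hd : 1 ≤ d) (G : Subgroup (Matrix.orthogonalGroup (Fin d) ℝ))
    (hG : Set.Finite (G : Set (Matrix.orthogonalGroup (Fin d) ℝ)))
    (x : ℕ → EuclideanSpace ℝ (Fin d)) :
    ∃ (G' : Subgroup (Matrix.orthogonalGroup (Fin d) ℝ)) (n : ℕ → ℕ),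
      G' ≤ G ∧ StrictMono n ∧
      (∀ g ∈ G', ∃ L : EuclideanSpace ℝ (Fin d),
        Filter.Tendsto (fun k => x (n k) - mvE (↑g : Matrix (Fin d) (Fin d) ℝ) (x (n k)))
          Filter.atTop (nhds L)) ∧
      (∀ g ∈ G, g ∉ G' →
        Filter.Tendsto (fun k => ‖x (n k) - mvE (↑g : Matrix (Fin d) (Fin d) ℝ) (x (n k))‖)
          Filter.atTop Filter.atTop) := by
  obtain ⟨n, hn, h⟩ := hG.exists_strictMono_tendsto_or_tendsto_norm_atTop
    fun g k => x k - mvE (↑g : Matrix (Fin d) (Fin d) ℝ) (x k)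
  refine ⟨displacementConvergenceSubgroup G (x ∘ n), n, fun g hg => hg.1, hn, fun g hg => hg.2,
    fun g hg hg' => (h g hg).resolve_left fun hL => hg' ⟨hg, hL⟩⟩
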